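/- Assume n > 0, m > 0, δ(u,v₁) > 0, δ(u,v₂) > 0, δ(v₁,v₂) ≥ 0, and (m²+n·m)·(δ(u,v₁)+δ(u,v₂)) − n·δ(v₁,v₂) ≤ 0. Then |δ(u,v₂)·det A₁| + |δ(u,v₁)·det A₂| + |det B₄| = |det B₃|; that is, the total ev×j-multiplicity is balanced when types α₁, α₂, α₄ lie on one side of the wall and α₃ on the other. -/

import Mathlib

/-- δ(x,y) = x₁y₂ − x₂y₁ for x, y ∈ ℝ². -/
def del (x y : ℝ × ℝ) : ℝ := x.1 * y.2 - x.2 * y.1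

/-- The 7×7 matrix A₁ (type α₁, flat cycle surviving on the e₂-side). -/
def A₁ (u v₁ v₂ : ℝ × ℝ) (n m : ℝ) : Matrix (Fin 7) (Fin 7) ℝ :=
  !![1, 0, 0,    0,    n*u.1, 0,       (n+m)*u.1;
     0, 1, 0,    0,    n*u.2, 0,       (n+m)*u.2;
     1, 0, v₁.1, 0,    0,     0,       0;
     0, 1, v₁.2, 0,    0,     0,       0;
     1, 0, 0,    v₂.1, 0,     n*m*u.1, (n+m)*u.1;
     0, 1, 0,    v₂.2, 0,     n*m*u.2, (n+m)*u.2;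
     0, 0, 0,    0,    0,     m+n,     0]

/-- The 7×7 matrix A₂ (type α₂, flat cycle surviving on the e₁-side): equal to A₁
except that the last entries of the first two rows are 0. -/
def A₂ (u v₁ v₂ : ℝ × ℝ) (n m : ℝ) : Matrix (Fin 7) (Fin 7) ℝ :=
  !![1, 0, 0,    0,    n*u.1, 0,       0;
     0, 1, 0,    0,    n*u.2, 0,       0;
     1, 0, v₁.1, 0,    0,     0,       0;
     0, 1, v₁.2, 0,    0,     0,       0;
     1, 0, 0,    v₂.1, 0,     n*m*u.1, (n+m)*u.1;
     0, 1, 0,    v₂.2, 0,     n*m*u.2, (n+m)*u.2;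
     0, 0, 0,    0,    0,     m+n,     0]

/-- The 9×9 matrix B₃ (non-degenerate type α₃). -/
def B₃ (u v₁ v₂ : ℝ × ℝ) (n m : ℝ) : Matrix (Fin 9) (Fin 9) ℝ :=
  !![1, 0, 0,    0,    n*u.1, 0,     0,        0,           0;
     0, 1, 0,    0,    n*u.2, 0,     0,        0,           0;
     1, 0, v₁.1, 0,    0,     0,     0,        0,           0;
     0, 1, v₁.2, 0,    0,     0,     0,        0,           0;
     1, 0, 0,    v₂.1, n*u.1, n*u.1, 0,        0,           0;
     0, 1, 0,    v₂.2, n*u.2, n*u.2, 0,        0,           0;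
     0, 0, 0,    0,    n*u.1, n*u.1, -(m*u.1), v₁.1+n*u.1,  -v₂.1+n*u.1;
     0, 0, 0,    0,    n*u.2, n*u.2, -(m*u.2), v₁.2+n*u.2,  -v₂.2+n*u.2;
     0, 0, 0,    0,    1,     1,     1,        1,           1]

/-- The 9×9 matrix B₄ (non-degenerate type α₄). -/
def B₄ (u v₁ v₂ : ℝ × ℝ) (n m : ℝ) : Matrix (Fin 9) (Fin 9) ℝ :=
  !![1, 0, 0,    0,    n*u.1, 0,     0,        -v₁.1-m*u.1, 0;
     0, 1, 0,    0,    n*u.2, 0,     0,        -v₁.2-m*u.2, 0;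
     1, 0, v₁.1, 0,    0,     0,     0,        0,           0;
     0, 1, v₁.2, 0,    0,     0,     0,        0,           0;
     1, 0, 0,    v₂.1, n*u.1, n*u.1, 0,        -v₁.1-m*u.1, v₂.1-m*u.1;
     0, 1, 0,    v₂.2, n*u.2, n*u.2, 0,        -v₁.2-m*u.2, v₂.2-m*u.2;
     0, 0, 0,    0,    n*u.1, n*u.1, -(m*u.1), -v₁.1-m*u.1, v₂.1-m*u.1;
     0, 0, 0,    0,    n*u.2, n*u.2, -(m*u.2), -v₁.2-m*u.2, v₂.2-m*u.2;
     0, 0, 0,    0,    1,     1,     1,        1,           1]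

/-- Clearing the first column of a matrix with corner entry `1` by row operations. -/
theorem det_eq_det_of_corner_eq_one {R : Type*} [CommRing R] {k : ℕ}
    (M : Matrix (Fin (k + 1)) (Fin (k + 1)) R) (h : M 0 0 = 1) :
    M.det =
      (Matrix.of fun i j : Fin k => M i.succ j.succ - M i.succ 0 * M 0 j.succ).det := by
  let N : Matrix (Fin (k + 1)) (Fin (k + 1)) R :=
    Matrix.of (Fin.cons (M 0) fun i j => M i.succ j - M i.succ 0 * M 0 j)
  have hN : M.det = N.det := by
    refine Matrix.det_eq_of_forall_row_eq_smul_add_const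
      (Fin.cons 0 fun i => M i.succ 0) 0 (by simp) fun i j => ?_
    cases i using Fin.cases <;> simp [N]
  rw [hN, Matrix.det_succ_column_zero, Fin.sum_univ_succ]
  simp only [N, h, Matrix.of_apply, Fin.cons_zero, Fin.cons_succ, mul_one, sub_self, mul_zero,
    zero_mul, Finset.sum_const_zero, add_zero, Fin.val_zero, pow_zero, one_mul]
  congr 1

theorem det_A₁ (u v₁ v₂ : ℝ × ℝ) (n m : ℝ) :
    (A₁ u v₁ v₂ n m).det =
      -(n * (n + m) ^ 2 * (del u v₁ * del u v₂)) := by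
  have h : (A₁ u v₁ v₂ n m).det = Matrix.det !![
      v₁.1, 0, -(n * u.1), 0, -((n + m) * u.1);
      v₁.2, 0, -(n * u.2), 0, -((n + m) * u.2);
      0, v₂.1, -(n * u.1), n * m * u.1, 0;
      0, v₂.2, -(n * u.2), n * m * u.2, 0;
      0, 0, 0, m + n, 0] := by
    rw [det_eq_det_of_corner_eq_one _ (by simp [A₁]),
      det_eq_det_of_corner_eq_one _ (by simp [A₁])]
    congr 1
    ext i j
    fin_cases i <;> fin_cases j <;> simp [A₁]
  rw [h]
  simp [del, Matrix.det_succ_row_zero, Fin.sum_univ_succ, Fin.succAbove]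
  ring

theorem det_A₂ (u v₁ v₂ : ℝ × ℝ) (n m : ℝ) :
    (A₂ u v₁ v₂ n m).det =
      -(n * (n + m) ^ 2 * (del u v₁ * del u v₂)) := by
  have h : (A₂ u v₁ v₂ n m).det = Matrix.det !![
      v₁.1, 0, -(n * u.1), 0, 0;
      v₁.2, 0, -(n * u.2), 0, 0;
      0, v₂.1, -(n * u.1), n * m * u.1, (n + m) * u.1;
      0, v₂.2, -(n * u.2), n * m * u.2, (n + m) * u.2;
      0, 0, 0, m + n, 0] := by
    rw [det_eq_det_of_corner_eq_one _ (by simp [A₂]),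
      det_eq_det_of_corner_eq_one _ (by simp [A₂])]
    congr 1
    ext i j
    fin_cases i <;> fin_cases j <;> simp [A₂]
  rw [h]
  simp [del, Matrix.det_succ_row_zero, Fin.sum_univ_succ, Fin.succAbove]
  ring

set_option maxHeartbeats 4000000 in
theorem det_B₃ (u v₁ v₂ : ℝ × ℝ) (n m : ℝ) :
    (B₃ u v₁ v₂ n m).det =
      -(n ^ 2 * (del u v₁ * del u v₂) * (del v₁ v₂ + (n + m) * (del u v₁ + del u v₂))) := by
  have h : (B₃ u v₁ v₂ n m).det = Matrix.det !![
      v₁.1, 0, -(n * u.1), 0, 0, 0, 0;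
      v₁.2, 0, -(n * u.2), 0, 0, 0, 0;
      0, v₂.1, 0, n * u.1, 0, 0, 0;
      0, v₂.2, 0, n * u.2, 0, 0, 0;
      0, 0, n * u.1, n * u.1, -(m * u.1), v₁.1 + n * u.1, -v₂.1 + n * u.1;
      0, 0, n * u.2, n * u.2, -(m * u.2), v₁.2 + n * u.2, -v₂.2 + n * u.2;
      0, 0, 1, 1, 1, 1, 1] := by
    rw [det_eq_det_of_corner_eq_one _ (by simp [B₃]),
      det_eq_det_of_corner_eq_one _ (by simp [B₃])]
    congr 1
    ext i j
    fin_cases i <;> fin_cases j <;> simp [B₃]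
  rw [h]
  simp [del, Matrix.det_succ_row_zero, Fin.sum_univ_succ, Fin.succAbove]
  ring

set_option maxHeartbeats 4000000 in
theorem det_B₄ (u v₁ v₂ : ℝ × ℝ) (n m : ℝ) :
    (B₄ u v₁ v₂ n m).det =
      n * (del u v₁ * del u v₂) * ((m ^ 2 + n * m) * (del u v₁ + del u v₂) - n * del v₁ v₂) := by
  have h : (B₄ u v₁ v₂ n m).det = Matrix.det !![
      v₁.1, 0, -(n * u.1), 0, 0, m * u.1 + v₁.1, 0;
      v₁.2, 0, -(n * u.2), 0, 0, m * u.2 + v₁.2, 0;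
      0, v₂.1, 0, n * u.1, 0, 0, v₂.1 - m * u.1;
      0, v₂.2, 0, n * u.2, 0, 0, v₂.2 - m * u.2;
      0, 0, n * u.1, n * u.1, -(m * u.1), -v₁.1 - m * u.1, v₂.1 - m * u.1;
      0, 0, n * u.2, n * u.2, -(m * u.2), -v₁.2 - m * u.2, v₂.2 - m * u.2;
      0, 0, 1, 1, 1, 1, 1] := by
    rw [det_eq_det_of_corner_eq_one _ (by simp [B₄]),
      det_eq_det_of_corner_eq_one _ (by simp [B₄])]
    congr 1
    ext i j
    fin_cases i <;> fin_cases j <;> simp [B₄]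
  rw [h]
  simp [del, Matrix.det_succ_row_zero, Fin.sum_univ_succ, Fin.succAbove]
  ring

/-- If (m²+nm)(δ(u,v₁)+δ(u,v₂)) − n·δ(v₁,v₂) ≤ 0, then the total ev×j-multiplicity is
balanced with types α₁, α₂, α₄ on one side of the wall and α₃ on the other. -/
theorem wall_balance_case2 (u v₁ v₂ : ℝ × ℝ) (n m : ℝ)
    (hn : 0 < n) (hm : 0 < m)
    (h₁ : 0 < del u v₁) (h₂ : 0 < del u v₂) (h₁₂ : 0 ≤ del v₁ v₂)
    (hcase : (m^2 + n*m) * (del u v₁ + del u v₂) - n * del v₁ v₂ ≤ 0) :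
    |del u v₂ * (A₁ u v₁ v₂ n m).det| + |del u v₁ * (A₂ u v₁ v₂ n m).det|
      + |(B₄ u v₁ v₂ n m).det| = |(B₃ u v₁ v₂ n m).det| := by
  have hp : 0 ≤ n * (del u v₁ * del u v₂) := by positivity
  rw [det_A₁, det_A₂, det_B₃, det_B₄, mul_neg, mul_neg, abs_neg, abs_neg, abs_neg,
    abs_of_nonneg (by positivity), abs_of_nonneg (by positivity),
    abs_of_nonpos (mul_nonpos_of_nonneg_of_nonpos hp hcase), abs_of_nonneg (by positivity)]
  ring
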